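/- Let α ∈ (0,∞) with α ≠ 1. Then I^{(1)}_α(P,W) = (α/(α−1))·log Tr[(Σ_i P(i)·W_i^α)^{1/α}], and the infimum defining I^{(1)}_α(P,W) is attained at the positive definite density matrix σ⋆ := (Σ_i P(i)·W_i^α)^{1/α} / Tr[(Σ_i P(i)·W_i^α)^{1/α}]; moreover σ⋆ is the unique minimizer, i.e., every positive definite density matrix τ ≠ σ⋆ yields a strictly larger value of (1/(α−1))·log Σ_i P(i)·Tr[W_i^α τ^{1−α}]. -/

import Mathlib

open Matrix
open scoped ComplexOrder

/-- Real power of a (hermitian) matrix via the continuous functional calculus. -/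
noncomputable def mpow {ι : Type*} [Fintype ι] [DecidableEq ι]
    (A : Matrix ι ι ℂ) (r : ℝ) : Matrix ι ι ℂ :=
  cfc (fun x : ℝ => x ^ r) A

/-- Logarithm of a (hermitian) matrix via the continuous functional calculus. -/
noncomputable def mlog {ι : Type*} [Fintype ι] [DecidableEq ι]
    (A : Matrix ι ι ℂ) : Matrix ι ι ℂ :=
  cfc Real.log A

/-- Real part of the trace. -/
noncomputable def trR {ι : Type*} [Fintype ι] (A : Matrix ι ι ℂ) : ℝ :=
  (Matrix.trace A).re

/-- Positive definite density matrices. -/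
def Dens (d : ℕ) : Type :=
  {σ : Matrix (Fin d) (Fin d) ℂ // σ.PosDef ∧ σ.trace = 1}

/-- Petz Rényi information of order `α ≠ 1`. -/
noncomputable def renyiInfo {d n : ℕ} (α : ℝ) (W : Fin n → Matrix (Fin d) (Fin d) ℂ)
    (P : Fin n → ℝ) : ℝ :=
  ⨅ σ : Dens d, (1 / (α - 1)) *
    Real.log (∑ i, P i * trR (mpow (W i) α * mpow σ.1 (1 - α)))

/-- Strict weighted Young inequality, with both signs of `α - 1` treated at once. -/
lemma young_strict {α a b : ℝ} (hα : 0 < α) (hα1 : α ≠ 1) (ha : 0 < a) (hb : 0 < b)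
    (hab : a ≠ b) :
    0 < (α - 1) * (a ^ α * b ^ (1 - α) - (α * a + (1 - α) * b)) := by
  have hs : -1 ≤ a / b - 1 := by have := (div_pos ha hb).le; linarith
  have hs' : a / b - 1 ≠ 0 := by
    rwa [sub_ne_zero, Ne, div_eq_one_iff_eq hb.ne']
  have hpow : a ^ α * b ^ (1 - α) = b * (1 + (a / b - 1)) ^ α := by
    rw [add_sub_cancel, Real.div_rpow ha.le hb.le, Real.rpow_sub hb, Real.rpow_one]
    ring
  have hlin : α * a + (1 - α) * b = b * (1 + α * (a / b - 1)) := by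
    field_simp
    ring
  rw [hpow, hlin, ← mul_sub]
  rcases lt_or_gt_of_ne hα1 with h | h
  · exact mul_pos_of_neg_of_neg (by linarith) (mul_neg_of_pos_of_neg hb
      (sub_neg.2 (rpow_one_add_lt_one_add_mul_self hs hs' hα h)))
  · exact mul_pos (by linarith) (mul_pos hb
      (sub_pos.2 (one_add_mul_self_lt_rpow_one_add hs hs' h)))

lemma trR_smul {ι : Type*} [Fintype ι] (c : ℝ) (A : Matrix ι ι ℂ) : trR (c • A) = c * trR A := by
  simp [trR, Matrix.trace_smul]

lemma trR_sum {ι κ : Type*} [Fintype ι] (s : Finset κ) (A : κ → Matrix ι ι ℂ) :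
    trR (∑ k ∈ s, A k) = ∑ k ∈ s, trR (A k) := by
  simp [trR, Matrix.trace_sum]

section

variable {ι : Type*} [Fintype ι] [DecidableEq ι]

lemma continuousOn_spectrum (f : ℝ → ℝ) {A : Matrix ι ι ℂ} (hA : A.IsHermitian) :
    ContinuousOn f (spectrum ℝ A) := by
  rw [hA.spectrum_real_eq_range_eigenvalues]
  exact (Set.finite_range _).continuousOn f

lemma continuousOn_image_spectrum (f g : ℝ → ℝ) {A : Matrix ι ι ℂ} (hA : A.IsHermitian) :
    ContinuousOn f (g '' spectrum ℝ A) := by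
  rw [hA.spectrum_real_eq_range_eigenvalues]
  exact ((Set.finite_range _).image g).continuousOn f

lemma Matrix.PosDef.spectrum_pos {A : Matrix ι ι ℂ} (hA : A.PosDef) {x : ℝ}
    (hx : x ∈ spectrum ℝ A) : 0 < x := by
  rw [hA.1.spectrum_real_eq_range_eigenvalues] at hx
  obtain ⟨i, rfl⟩ := hx
  exact hA.eigenvalues_pos i

lemma mpow_eq_cfc (A : Matrix ι ι ℂ) (r : ℝ) : mpow A r = cfc (fun x : ℝ => x ^ r) A := rfl

lemma posDef_mpow {A : Matrix ι ι ℂ} (hA : A.PosDef) (r : ℝ) : (mpow A r).PosDef := by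
  have hherm : (mpow A r).IsHermitian := cfc_predicate (fun x : ℝ => x ^ r) A
  rw [hherm.posDef_iff_eigenvalues_pos]
  intro i
  have hi := hherm.eigenvalues_mem_spectrum_real i
  have hspec : spectrum ℝ (mpow A r) = (fun x : ℝ => x ^ r) '' spectrum ℝ A :=
    cfc_map_spectrum _ A hA.1 (continuousOn_spectrum _ hA.1)
  rw [hspec] at hi
  obtain ⟨x, hx, hxi⟩ := hi
  rw [← hxi]
  exact Real.rpow_pos_of_pos (hA.spectrum_pos hx) r

lemma mpow_one {A : Matrix ι ι ℂ} (hA : A.IsHermitian) : mpow A 1 = A := by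
  have h : cfc (fun x : ℝ => x) A = A := cfc_id' ℝ A hA
  simpa only [mpow_eq_cfc, Real.rpow_one] using h

lemma mpow_mpow {A : Matrix ι ι ℂ} (hA : A.PosDef) (r s : ℝ) :
    mpow (mpow A r) s = mpow A (r * s) := by
  have h : cfc (fun x : ℝ => (x ^ r) ^ s) A = mpow (mpow A r) s :=
    cfc_comp' (fun x : ℝ => x ^ s) (fun x : ℝ => x ^ r) A
      (continuousOn_image_spectrum _ _ hA.1) (continuousOn_spectrum _ hA.1) hA.1
  rw [← h]
  exact cfc_congr fun x hx => (Real.rpow_mul (hA.spectrum_pos hx).le r s).symm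

lemma mpow_mul_mpow {A : Matrix ι ι ℂ} (hA : A.PosDef) (r s : ℝ) :
    mpow A r * mpow A s = mpow A (r + s) := by
  simp only [mpow_eq_cfc]
  rw [← cfc_mul _ _ A (continuousOn_spectrum _ hA.1) (continuousOn_spectrum _ hA.1)]
  exact cfc_congr fun x hx => (Real.rpow_add (hA.spectrum_pos hx) r s).symm

lemma mpow_smul {A : Matrix ι ι ℂ} (hA : A.PosDef) {c : ℝ} (hc : 0 < c) (r : ℝ) :
    mpow (c • A) r = c ^ r • mpow A r := by
  have h : cfc (fun x : ℝ => (c * x) ^ r) A = mpow (c • A) r :=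
    cfc_comp_const_mul c (fun x : ℝ => x ^ r) A (continuousOn_image_spectrum _ _ hA.1) hA.1
  have h' : cfc (fun x : ℝ => c ^ r • x ^ r) A = c ^ r • mpow A r :=
    cfc_smul (c ^ r) (fun x : ℝ => x ^ r) A (continuousOn_spectrum _ hA.1)
  rw [← h, ← h']
  exact cfc_congr fun x hx => Real.mul_rpow hc.le (hA.spectrum_pos hx).le

lemma trR_mul_pos [Nonempty ι] {A B : Matrix ι ι ℂ} (hA : A.PosDef) (hB : B.PosDef) :
    0 < trR (A * B) := by
  have hS := posDef_mpow hA (1 / 2)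
  have hSS : mpow A (1 / 2) * mpow A (1 / 2) = A := by
    rw [mpow_mul_mpow hA, add_halves, mpow_one hA.1]
  have hpos : ((mpow A (1 / 2))ᴴ * B * mpow A (1 / 2)).PosDef :=
    hB.conjTranspose_mul_mul_same (mulVec_injective_of_isUnit hS.isUnit)
  have htr : (A * B).trace = ((mpow A (1 / 2))ᴴ * B * mpow A (1 / 2)).trace := by
    rw [hS.1.eq, Matrix.trace_mul_comm (_ * B), ← mul_assoc, hSS]
  unfold trR
  rw [htr]
  exact (Complex.pos_iff.1 hpos.trace_pos).1

/-- The trace of a product of functions of two hermitian matrices, expanded in their joint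
Nussbaum–Szkoła weights. -/
lemma exists_trR_cfc_mul_cfc {A B : Matrix ι ι ℂ} (hA : A.IsHermitian) (hB : B.IsHermitian) :
    ∃ c : ι → ι → ℝ, (∀ i j, 0 ≤ c i j) ∧ ∀ f g : ℝ → ℝ,
      trR (cfc f A * cfc g B) =
        ∑ i, ∑ j, c i j * (f (hA.eigenvalues i) * g (hB.eigenvalues j)) := by
  set U : Matrix ι ι ℂ := ↑hA.eigenvectorUnitary with hU
  set V : Matrix ι ι ℂ := ↑hB.eigenvectorUnitary with hV
  refine ⟨fun i j => Complex.normSq ((star U * V) i j), fun i j => Complex.normSq_nonneg _,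
    fun f g => ?_⟩
  rw [hA.cfc_eq, hB.cfc_eq, IsHermitian.cfc, IsHermitian.cfc, Unitary.conjStarAlgAut_apply,
    Unitary.conjStarAlgAut_apply, ← hU, ← hV]
  set D : Matrix ι ι ℂ := diagonal (RCLike.ofReal ∘ f ∘ hA.eigenvalues) with hD
  set E : Matrix ι ι ℂ := diagonal (RCLike.ofReal ∘ g ∘ hB.eigenvalues) with hE
  have hcyc : (U * D * star U * (V * E * star V)).trace
      = (D * (star U * V) * E * star (star U * V)).trace := by
    rw [star_mul, star_star, mul_assoc U, mul_assoc U, Matrix.trace_mul_comm]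
    simp only [mul_assoc]
  unfold trR
  rw [hcyc]
  simp only [Matrix.trace, Matrix.diag, Complex.re_sum]
  refine Finset.sum_congr rfl fun i _ => ?_
  rw [Matrix.mul_apply, Complex.re_sum]
  refine Finset.sum_congr rfl fun j _ => ?_
  rw [hD, hE, Matrix.mul_diagonal, Matrix.diagonal_mul, Matrix.star_apply]
  set z := (star U * V) i j
  simp [Complex.normSq_apply]
  ring

/-- Faithfulness of the Petz Rényi divergence of positive definite matrices of equal unit trace. -/
lemma petz_trace_strict {ρ σ : Matrix ι ι ℂ} (hρ : ρ.PosDef) (hσ : σ.PosDef)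
    (hρ1 : ρ.trace = 1) (hσ1 : σ.trace = 1) {α : ℝ} (hα : 0 < α) (hα1 : α ≠ 1) (hne : σ ≠ ρ) :
    0 < (α - 1) * (trR (mpow ρ α * mpow σ (1 - α)) - 1) := by
  obtain ⟨c, hc, hcfc⟩ := exists_trR_cfc_mul_cfc hρ.1 hσ.1
  have hidρ : cfc (fun x : ℝ => x) ρ = ρ := cfc_id' ℝ ρ hρ.1
  have hidσ : cfc (fun x : ℝ => x) σ = σ := cfc_id' ℝ σ hσ.1
  have honeρ : cfc (fun _ : ℝ => (1 : ℝ)) ρ = 1 := cfc_const_one ℝ ρ hρ.1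
  have honeσ : cfc (fun _ : ℝ => (1 : ℝ)) σ = 1 := cfc_const_one ℝ σ hσ.1
  have hsqρ : cfc (fun x : ℝ => x ^ 2) ρ = ρ ^ 2 := cfc_pow_id ρ 2 hρ.1
  have hsqσ : cfc (fun x : ℝ => x ^ 2) σ = σ ^ 2 := cfc_pow_id σ 2 hσ.1
  set r := hρ.1.eigenvalues
  set s := hσ.1.eigenvalues
  have hρs : ∑ i, ∑ j, c i j * r i = 1 := by
    have h := hcfc (fun x => x) (fun _ => 1)
    rw [hidρ, honeσ] at h
    simpa [trR, hρ1] using h.symm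
  have hσs : ∑ i, ∑ j, c i j * s j = 1 := by
    have h := hcfc (fun _ => 1) (fun x => x)
    rw [hidσ, honeρ] at h
    simpa [trR, hσ1] using h.symm
  have hsq : trR ((ρ - σ) ^ 2) = ∑ i, ∑ j, c i j * (r i - s j) ^ 2 := by
    have h1 := hcfc (fun x => x ^ 2) (fun _ => 1)
    have h2 := hcfc (fun x => x) (fun x => x)
    have h3 := hcfc (fun _ => 1) (fun x => x ^ 2)
    rw [hsqρ, honeσ, mul_one] at h1
    rw [hidρ, hidσ] at h2
    rw [hsqσ, honeρ, one_mul] at h3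
    have hexp : trR ((ρ - σ) ^ 2) = trR (ρ ^ 2) - 2 * trR (ρ * σ) + trR (σ ^ 2) := by
      simp only [trR, sq, mul_sub, sub_mul, Matrix.trace_sub, Complex.sub_re,
        Matrix.trace_mul_comm σ ρ]
      ring
    rw [hexp, h1, h2, h3]
    simp only [Finset.mul_sum, ← Finset.sum_sub_distrib, ← Finset.sum_add_distrib]
    refine Finset.sum_congr rfl fun i _ => Finset.sum_congr rfl fun j _ => by ring
  set φ : ι → ι → ℝ := fun i j =>
    (α - 1) * (r i ^ α * s j ^ (1 - α) - (α * r i + (1 - α) * s j)) with hφ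
  have hφpos : ∀ i j, r i ≠ s j → 0 < φ i j := fun i j h =>
    young_strict hα hα1 (hρ.eigenvalues_pos i) (hσ.eigenvalues_pos j) h
  have hφnn : ∀ i j, 0 ≤ φ i j := fun i j => by
    by_cases h : r i = s j
    · have hs : 0 < s j := hσ.eigenvalues_pos j
      have hz : φ i j = 0 := by
        simp only [hφ, h, ← Real.rpow_add hs, add_sub_cancel, Real.rpow_one]
        ring
      exact hz.ge
    · exact (hφpos i j h).le
  have hgap : (α - 1) * (trR (mpow ρ α * mpow σ (1 - α)) - 1) = ∑ i, ∑ j, c i j * φ i j := by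
    have h : α * (∑ i, ∑ j, c i j * r i) + (1 - α) * ∑ i, ∑ j, c i j * s j = 1 := by
      rw [hρs, hσs]; ring
    calc (α - 1) * (trR (mpow ρ α * mpow σ (1 - α)) - 1)
        = (α - 1) * (trR (mpow ρ α * mpow σ (1 - α)) -
            (α * (∑ i, ∑ j, c i j * r i) + (1 - α) * ∑ i, ∑ j, c i j * s j)) := by rw [h]
      _ = ∑ i, ∑ j, c i j * φ i j := by
        rw [mpow_eq_cfc, mpow_eq_cfc, hcfc]
        simp only [Finset.mul_sum, ← Finset.sum_sub_distrib, ← Finset.sum_add_distrib]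
        refine Finset.sum_congr rfl fun i _ => Finset.sum_congr rfl fun j _ => ?_
        simp only [hφ]
        ring
  rw [hgap]
  have hterm : ∀ i j, 0 ≤ c i j * φ i j := fun i j => mul_nonneg (hc i j) (hφnn i j)
  refine lt_of_le_of_ne (Finset.sum_nonneg fun i _ => Finset.sum_nonneg fun j _ => hterm i j) ?_
  intro h0
  have hzero : ∀ i j, c i j * φ i j = 0 := by
    intro i j
    have hi := (Finset.sum_eq_zero_iff_of_nonneg
      (fun i _ => Finset.sum_nonneg fun j _ => hterm i j)).1 h0.symm i (Finset.mem_univ i)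
    exact (Finset.sum_eq_zero_iff_of_nonneg (fun j _ => hterm i j)).1 hi j (Finset.mem_univ j)
  have hdist : trR ((ρ - σ) ^ 2) = 0 := by
    rw [hsq]
    refine Finset.sum_eq_zero fun i _ => Finset.sum_eq_zero fun j _ => ?_
    by_cases h : r i = s j
    · simp [h]
    · rw [(mul_eq_zero.1 (hzero i j)).resolve_right (hφpos i j h).ne', zero_mul]
  have hherm : (ρ - σ)ᴴ = ρ - σ := (hρ.1.sub hσ.1).eq
  have hnn : 0 ≤ ((ρ - σ)ᴴ * (ρ - σ)).trace :=
    (Matrix.posSemidef_conjTranspose_mul_self (ρ - σ)).trace_nonneg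
  have htr : ((ρ - σ)ᴴ * (ρ - σ)).trace = 0 := by
    refine Complex.ext ?_ (Complex.nonneg_iff.1 hnn).2.symm
    rw [hherm, ← sq]
    exact hdist
  exact hne (sub_eq_zero.1 (Matrix.trace_conjTranspose_mul_self_eq_zero_iff.1 htr)).symm

end

/-- A positive combination of positive definite matrices is positive definite. -/
lemma posDef_sum_smul {ι κ : Type*} [Fintype ι] [Fintype κ]
    {P : κ → ℝ} (hP : ∀ k, 0 ≤ P k) (hP1 : ∑ k, P k = 1) {A : κ → Matrix ι ι ℂ}
    (hA : ∀ k, (A k).PosDef) : (∑ k, P k • A k).PosDef := by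
  classical
  have hex : ∃ k, P k ≠ 0 := by
    by_contra! h
    simp [h] at hP1
  obtain ⟨k, hk⟩ := hex
  rw [← Finset.add_sum_erase _ _ (Finset.mem_univ k)]
  exact ((hA k).smul ((hP k).lt_of_ne' hk)).add_posSemidef
    (Matrix.posSemidef_sum _ fun l _ => (hA l).posSemidef.smul (hP l))

/-- closed form for the Petz Rényi information; the infimum is
attained at `σ⋆`, which is the unique minimizer. -/
theorem renyiInfo_closed_form_unique_minimizer {d n : ℕ} (hd : 0 < d) (hn : 0 < n)
    (W : Fin n → Matrix (Fin d) (Fin d) ℂ)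
    (hW : ∀ i, (W i).PosDef ∧ (W i).trace = 1)
    (P : Fin n → ℝ) (hP : ∀ i, 0 ≤ P i) (hP1 : ∑ i, P i = 1)
    (α : ℝ) (hα : 0 < α) (hα1 : α ≠ 1)
    (σstar : Matrix (Fin d) (Fin d) ℂ)
    (hσstar : σstar = (trR (mpow (∑ i, P i • mpow (W i) α) (1 / α)))⁻¹ •
      mpow (∑ i, P i • mpow (W i) α) (1 / α)) :
    renyiInfo α W P =
        (α / (α - 1)) * Real.log (trR (mpow (∑ i, P i • mpow (W i) α) (1 / α))) ∧
    σstar.PosDef ∧ σstar.trace = 1 ∧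
    renyiInfo α W P =
        (1 / (α - 1)) * Real.log (∑ i, P i * trR (mpow (W i) α * mpow σstar (1 - α))) ∧
    (∀ τ : Matrix (Fin d) (Fin d) ℂ, τ.PosDef → τ.trace = 1 → τ ≠ σstar →
      renyiInfo α W P <
        (1 / (α - 1)) * Real.log (∑ i, P i * trR (mpow (W i) α * mpow τ (1 - α)))) := by
  have : Nonempty (Fin d) := ⟨⟨0, hd⟩⟩
  set A : Matrix (Fin d) (Fin d) ℂ := ∑ i, P i • mpow (W i) α with hAdef
  have hA : A.PosDef := posDef_sum_smul hP hP1 fun i => posDef_mpow (hW i).1 α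
  set ω := mpow A (1 / α) with hω
  have hωpos : ω.PosDef := posDef_mpow hA _
  set T := trR ω with hT
  have hTc := Complex.pos_iff.1 hωpos.trace_pos
  have hTpos : 0 < T := hTc.1
  have htr : ω.trace = (T : ℂ) := Complex.ext rfl hTc.2.symm
  have hσpos : σstar.PosDef := hσstar ▸ hωpos.smul (inv_pos.2 hTpos)
  have hσtr : σstar.trace = 1 := by
    rw [hσstar, Matrix.trace_smul, htr, Complex.real_smul, ← Complex.ofReal_mul,
      inv_mul_cancel₀ hTpos.ne', Complex.ofReal_one]
  have hωσ : ω = T • σstar := by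
    rw [hσstar, smul_smul, mul_inv_cancel₀ hTpos.ne', one_smul]
  have hAσ : A = T ^ α • mpow σstar α := by
    rw [← mpow_smul hσpos hTpos, ← hωσ, hω, mpow_mpow hA, one_div_mul_cancel hα.ne', mpow_one hA.1]
  have hobj : ∀ τ : Matrix (Fin d) (Fin d) ℂ,
      ∑ i, P i * trR (mpow (W i) α * mpow τ (1 - α))
        = T ^ α * trR (mpow σstar α * mpow τ (1 - α)) := by
    intro τ
    rw [← trR_smul, ← smul_mul_assoc, ← hAσ, hAdef, Finset.sum_mul, trR_sum]
    simp only [smul_mul_assoc, trR_smul]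
  have hTα : 0 < T ^ α := Real.rpow_pos_of_pos hTpos α
  have hself : trR (mpow σstar α * mpow σstar (1 - α)) = 1 := by
    rw [mpow_mul_mpow hσpos, add_sub_cancel, mpow_one hσpos.1]
    simp [trR, hσtr]
  have hvalue : (1 / (α - 1)) * Real.log (∑ i, P i * trR (mpow (W i) α * mpow σstar (1 - α)))
      = (α / (α - 1)) * Real.log T := by
    rw [hobj, hself, mul_one, Real.log_rpow hTpos]
    ring
  have hstrict : ∀ τ : Matrix (Fin d) (Fin d) ℂ, τ.PosDef → τ.trace = 1 → τ ≠ σstar →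
      (α / (α - 1)) * Real.log T <
        (1 / (α - 1)) * Real.log (∑ i, P i * trR (mpow (W i) α * mpow τ (1 - α))) := by
    intro τ hτ hτ1 hne
    have hgap := petz_trace_strict hσpos hτ hσtr hτ1 hα hα1 hne
    have hQ : 0 < trR (mpow σstar α * mpow τ (1 - α)) :=
      trR_mul_pos (posDef_mpow hσpos α) (posDef_mpow hτ (1 - α))
    rw [hobj, Real.log_mul hTα.ne' hQ.ne', Real.log_rpow hTpos]
    set q := trR (mpow σstar α * mpow τ (1 - α))
    have hlog : 0 < (1 / (α - 1)) * Real.log q := by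
      rcases lt_or_gt_of_ne hα1 with h | h
      · exact mul_pos_of_neg_of_neg (one_div_neg.2 (by linarith))
          (Real.log_neg hQ (by nlinarith))
      · exact mul_pos (one_div_pos.2 (by linarith)) (Real.log_pos (by nlinarith))
    have hsplit : (1 / (α - 1)) * (α * Real.log T + Real.log q)
        = (α / (α - 1)) * Real.log T + (1 / (α - 1)) * Real.log q := by ring
    linarith
  have hinf : renyiInfo α W P = (α / (α - 1)) * Real.log T := by
    refine IsLeast.csInf_eq ⟨⟨⟨σstar, hσpos, hσtr⟩, hvalue⟩, ?_⟩
    rintro _ ⟨⟨τ, hτ, hτ1⟩, rfl⟩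
    by_cases h : τ = σstar
    · subst h
      exact hvalue.ge
    · exact (hstrict τ hτ hτ1 h).le
  exact ⟨hinf, hσpos, hσtr, hinf.trans hvalue.symm,
    fun τ hτ hτ1 hne => hinf ▸ hstrict τ hτ hτ1 hne⟩
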